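/- For all real s,t > 0 and every polynomial function f : ℝ² → ℝ, the generator of the continuous generalized Immediate Exchange Model commutes with the SU(1,1) lowering operator 𝒦⁻₁ + 𝒦⁻₂: for all x,y ≥ 0, L_{s,t}((𝒦⁻₁+𝒦⁻₂)f)(x,y) = (𝒦⁻₁+𝒦⁻₂)(L_{s,t} f)(x,y), where (𝒦⁻₁+𝒦⁻₂)f(x,y) = x ∂²f/∂x² + (s+t) ∂f/∂x + y ∂²f/∂y² + (s+t) ∂f/∂y. -/

import Mathlib

open MeasureTheory Real

/-- The Beta function `B(s,t) = Γ(s)Γ(t)/Γ(s+t)`. -/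
noncomputable def betaFn (s t : ℝ) : ℝ := Real.Gamma s * Real.Gamma t / Real.Gamma (s + t)

/-- Joint density of two independent Beta(s,t) random variables. -/
noncomputable def phiBeta (s t u v : ℝ) : ℝ :=
  (1 / betaFn s t) ^ 2 * u ^ (s - 1) * (1 - u) ^ (t - 1) * v ^ (s - 1) * (1 - v) ^ (t - 1)

/-- Generator of the continuous generalized Immediate Exchange Model. -/
noncomputable def contGen (s t : ℝ) (f : ℝ → ℝ → ℝ) (x y : ℝ) : ℝ :=
  ∫ u in (0:ℝ)..1, ∫ v in (0:ℝ)..1,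
    (f (x * (1 - u) + y * v) (y * (1 - v) + x * u) - f x y) * phiBeta s t u v

/-- The continuous SU(1,1) lowering operator `𝒦⁻₁+𝒦⁻₂`:
`((𝒦⁻₁+𝒦⁻₂)f)(x,y) = x ∂²f/∂x² + (s+t) ∂f/∂x + y ∂²f/∂y² + (s+t) ∂f/∂y`. -/
noncomputable def contKminus (s t : ℝ) (f : ℝ → ℝ → ℝ) (x y : ℝ) : ℝ :=
  x * deriv (fun x' => deriv (fun x'' => f x'' y) x') x
    + (s + t) * deriv (fun x' => f x' y) x
    + y * deriv (fun y' => deriv (fun y'' => f x y'') y') y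
    + (s + t) * deriv (fun y' => f x y') y

open ProbabilityTheory Set

/-- Evaluation of a bivariate polynomial. -/
noncomputable def ev2 (p : MvPolynomial (Fin 2) ℝ) (x y : ℝ) : ℝ := MvPolynomial.eval ![x, y] p

lemma ev2_hasDerivAt (p : MvPolynomial (Fin 2) ℝ) (X Y : ℝ → ℝ) (X' Y' a : ℝ)
    (hX : HasDerivAt X X' a) (hY : HasDerivAt Y Y' a) :
    HasDerivAt (fun τ => ev2 p (X τ) (Y τ))
      (X' * ev2 (MvPolynomial.pderiv 0 p) (X a) (Y a)
        + Y' * ev2 (MvPolynomial.pderiv 1 p) (X a) (Y a)) a := by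
  unfold ev2
  induction p using MvPolynomial.induction_on with
  | C c => simpa using hasDerivAt_const a c
  | add p q hp hq =>
    simp only [map_add]
    refine (hp.add hq).congr_deriv ?_
    ring
  | mul_X p i hp =>
    fin_cases i
    · simp only [map_mul, MvPolynomial.pderiv_mul, MvPolynomial.eval_X, map_add]
      refine (hp.mul hX).congr_deriv ?_
      simp [MvPolynomial.pderiv_X]
      ring
    · simp only [map_mul, MvPolynomial.pderiv_mul, MvPolynomial.eval_X, map_add]
      refine (hp.mul hY).congr_deriv ?_
      simp [MvPolynomial.pderiv_X]
      ring

@[fun_prop]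
lemma ev2_continuous {α : Type*} [TopologicalSpace α] (p : MvPolynomial (Fin 2) ℝ) (X Y : α → ℝ)
    (hX : Continuous X) (hY : Continuous Y) : Continuous (fun a => ev2 p (X a) (Y a)) := by
  unfold ev2
  induction p using MvPolynomial.induction_on with
  | C c => simpa using continuous_const
  | add p q hp hq =>
    simp only [map_add]
    fun_prop
  | mul_X p i hp =>
    fin_cases i
    · simp only [map_mul, MvPolynomial.eval_X]
      exact hp.mul hX
    · simp only [map_mul, MvPolynomial.eval_X]
      exact hp.mul hY

lemma beta_integral {s t : ℝ} (hs : 0 < s) (ht : 0 < t) (g : ℝ → ℝ) :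
    ∫ u, g u ∂(betaMeasure s t)
      = ∫ u in (0:ℝ)..1, g u * (1 / betaFn s t * u ^ (s - 1) * (1 - u) ^ (t - 1)) := by
  rw [betaMeasure, integral_withDensity_eq_integral_toReal_smul
    (by unfold betaPDF; fun_prop) (by simp [betaPDF])]
  rw [intervalIntegral.integral_of_le zero_le_one, integral_Ioc_eq_integral_Ioo,
    ← integral_indicator measurableSet_Ioo]
  congr 1
  ext u
  by_cases hu : u ∈ Ioo (0:ℝ) 1
  · rw [indicator_of_mem hu, betaPDF, ENNReal.toReal_ofReal (betaPDFReal_pos hu.1 hu.2 hs ht).le,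
      betaPDFReal, if_pos ⟨hu.1, hu.2⟩, smul_eq_mul, mul_comm]
    rfl
  · have h2 : ¬ (0 < u ∧ u < 1) := hu
    rw [indicator_of_notMem hu, betaPDF, betaPDFReal, if_neg h2]
    simp

lemma beta_ae (s t : ℝ) : ∀ᵐ u ∂(betaMeasure s t), u ∈ Icc (0:ℝ) 1 := by
  rw [betaMeasure, ae_withDensity_iff (by unfold betaPDF; fun_prop)]
  refine Filter.Eventually.of_forall fun u hu => ?_
  constructor
  · by_contra h
    exact hu (betaPDF_eq_zero_of_nonpos (by linarith))
  · by_contra h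
    exact hu (betaPDF_eq_zero_of_one_le (by linarith))

lemma integrable_of_cont {α : Type*} [TopologicalSpace α] [MeasurableSpace α] [OpensMeasurableSpace α]
    (μ : Measure α) [IsProbabilityMeasure μ] (K : Set α) (hK : IsCompact K)
    (hμ : ∀ᵐ a ∂μ, a ∈ K) (g : α → ℝ) (hg : Continuous g) : Integrable g μ := by
  obtain ⟨C, hC⟩ := hK.exists_bound_of_continuousOn hg.continuousOn
  exact Integrable.of_bound hg.aestronglyMeasurable C (hμ.mono fun a ha => hC a ha)

lemma hasDerivAt_param (μ : Measure (ℝ × ℝ)) [IsProbabilityMeasure μ] (K : Set (ℝ × ℝ))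
    (hK : IsCompact K) (hμ : ∀ᵐ a ∂μ, a ∈ K) (g g' : ℝ → ℝ × ℝ → ℝ)
    (hg : ∀ x, Continuous (g x)) (hg' : Continuous (fun q : ℝ × (ℝ × ℝ) => g' q.1 q.2))
    (hd : ∀ x a, HasDerivAt (fun x => g x a) (g' x a) x) (x : ℝ) :
    HasDerivAt (fun x => ∫ a, g x a ∂μ) (∫ a, g' x a ∂μ) x := by
  obtain ⟨C, hC⟩ := ((isCompact_closedBall x 1).prod hK).exists_bound_of_continuousOn
    hg'.continuousOn
  refine (hasDerivAt_integral_of_dominated_loc_of_deriv_le (bound := fun _ => C)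
    (Metric.closedBall_mem_nhds x one_pos)
    (Filter.Eventually.of_forall fun z => (hg z).aestronglyMeasurable)
    (integrable_of_cont μ K hK hμ _ (hg x)) ?_ ?_ (integrable_const C) ?_).2
  · have : Continuous (g' x) := hg'.comp (by fun_prop : Continuous fun a : ℝ × ℝ => (x, a))
    exact this.aestronglyMeasurable
  · exact hμ.mono fun a ha z hz => hC (z, a) ⟨hz, ha⟩
  · exact Filter.Eventually.of_forall fun a z _ => hd z a

lemma beta_ibp {s t : ℝ} (hs : 0 < s) (ht : 0 < t) (h h' : ℝ → ℝ)
    (hc' : Continuous h') (hd : ∀ u, HasDerivAt h (h' u) u) :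
    ∫ u, (u * (1 - u) * h' u + (s - (s + t) * u) * h u) ∂(betaMeasure s t) = 0 := by
  have hc : Continuous h := continuous_iff_continuousAt.2 fun u => (hd u).continuousAt
  have := isProbabilityMeasureBeta hs ht
  set k : ℝ → ℝ := fun u => u * (1 - u) * h' u + (s - (s + t) * u) * h u with hk
  have hkc : Continuous k := by fun_prop
  have hki : Integrable k (betaMeasure s t) :=
    integrable_of_cont _ _ isCompact_Icc (beta_ae s t) k hkc
  rw [beta_integral hs ht]
  have key := intervalIntegral.integral_eq_sub_of_hasDerivAt_of_le (a := 0) (b := 1)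
    (f := fun u => 1 / betaFn s t * (u ^ s * (1 - u) ^ t * h u))
    (f' := fun u => k u * (1 / betaFn s t * u ^ (s - 1) * (1 - u) ^ (t - 1)))
    zero_le_one ?_ ?_ ?_
  · rw [key]
    simp [Real.zero_rpow hs.ne', Real.zero_rpow ht.ne']
  · apply Continuous.continuousOn
    have h1 : Continuous fun u : ℝ => u ^ s := Real.continuous_rpow_const hs.le
    have h2 : Continuous fun u : ℝ => (1 - u) ^ t :=
      (Real.continuous_rpow_const ht.le).comp (by fun_prop)
    fun_prop
  · intro u hu
    have hu1 : 0 < 1 - u := by linarith [hu.2]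
    have d1 := Real.hasDerivAt_rpow_const (x := u) (p := s) (Or.inl hu.1.ne')
    have d2 := (((hasDerivAt_id u).const_sub 1)).rpow_const (p := t) (Or.inl hu1.ne')
    have e1 : u ^ s = u ^ (s - 1) * u := by
      rw [← Real.rpow_add_one hu.1.ne']; ring_nf
    have e2 : (1 - u) ^ t = (1 - u) ^ (t - 1) * (1 - u) := by
      rw [← Real.rpow_add_one hu1.ne']; ring_nf
    refine (((d1.mul d2).mul (hd u)).const_mul (1 / betaFn s t)).congr_deriv ?_
    simp only [hk, id, Pi.mul_apply]
    rw [e1, e2]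
    ring
  · rw [intervalIntegrable_iff_integrableOn_Ioo_of_le zero_le_one]
    rw [betaMeasure, integrable_withDensity_iff_integrable_smul'
      (by unfold betaPDF; fun_prop) (by simp [betaPDF])] at hki
    refine (hki.integrableOn (s := Ioo 0 1)).congr_fun ?_ measurableSet_Ioo
    intro u hu
    simp only []
    rw [betaPDF, ENNReal.toReal_ofReal (betaPDFReal_pos hu.1 hu.2 hs ht).le,
      betaPDFReal, if_pos ⟨hu.1, hu.2⟩, smul_eq_mul, mul_comm]
    rfl

/-- Product of the two Beta laws. -/
noncomputable def bb (s t : ℝ) : Measure (ℝ × ℝ) := (betaMeasure s t).prod (betaMeasure s t)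

lemma bb_prob {s t : ℝ} (hs : 0 < s) (ht : 0 < t) : IsProbabilityMeasure (bb s t) := by
  have := isProbabilityMeasureBeta hs ht
  unfold bb
  infer_instance

lemma bb_ae {s t : ℝ} (hs : 0 < s) (ht : 0 < t) :
    ∀ᵐ a ∂(bb s t), a ∈ Icc (0:ℝ) 1 ×ˢ Icc (0:ℝ) 1 := by
  have := isProbabilityMeasureBeta hs ht
  unfold bb
  have h1 := Measure.quasiMeasurePreserving_fst (μ := betaMeasure s t) (ν := betaMeasure s t)
    |>.ae (beta_ae s t)
  have h2 := Measure.quasiMeasurePreserving_snd (μ := betaMeasure s t) (ν := betaMeasure s t)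
    |>.ae (beta_ae s t)
  filter_upwards [h1, h2] with a ha hb using ⟨ha, hb⟩

lemma bb_integrable {s t : ℝ} (hs : 0 < s) (ht : 0 < t) (g : ℝ × ℝ → ℝ) (hg : Continuous g) :
    Integrable g (bb s t) := by
  have := bb_prob hs ht
  exact integrable_of_cont _ _ (isCompact_Icc.prod isCompact_Icc) (bb_ae hs ht) g hg

lemma bb_deriv {s t : ℝ} (hs : 0 < s) (ht : 0 < t) (g g' : ℝ → ℝ × ℝ → ℝ)
    (hg : ∀ x, Continuous (g x)) (hg' : Continuous (fun q : ℝ × (ℝ × ℝ) => g' q.1 q.2))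
    (hd : ∀ x a, HasDerivAt (fun x => g x a) (g' x a) x) (x : ℝ) :
    HasDerivAt (fun x => ∫ a, g x a ∂(bb s t)) (∫ a, g' x a ∂(bb s t)) x := by
  have := bb_prob hs ht
  exact hasDerivAt_param _ _ (isCompact_Icc.prod isCompact_Icc) (bb_ae hs ht) g g' hg hg' hd x

lemma contGen_eq {s t : ℝ} (hs : 0 < s) (ht : 0 < t) (p : MvPolynomial (Fin 2) ℝ) (x y : ℝ) :
    contGen s t (ev2 p) x y
      = ∫ a, ev2 p (x * (1 - a.1) + y * a.2) (y * (1 - a.2) + x * a.1) ∂(bb s t) - ev2 p x y := by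
  have := bb_prob hs ht
  have := isProbabilityMeasureBeta hs ht
  have e : ∫ a, ev2 p (x * (1 - a.1) + y * a.2) (y * (1 - a.2) + x * a.1) ∂(bb s t) - ev2 p x y
      = ∫ a, (ev2 p (x * (1 - a.1) + y * a.2) (y * (1 - a.2) + x * a.1) - ev2 p x y) ∂(bb s t) := by
    rw [integral_sub (bb_integrable hs ht _ (by fun_prop)) (integrable_const _)]
    simp
  rw [e]
  have hi := bb_integrable hs ht
    (fun a => ev2 p (x * (1 - a.1) + y * a.2) (y * (1 - a.2) + x * a.1) - ev2 p x y) (by fun_prop)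
  unfold bb at hi ⊢
  rw [integral_prod _ hi, beta_integral hs ht]
  unfold contGen
  congr 1
  ext u
  rw [beta_integral hs ht, ← intervalIntegral.integral_mul_const]
  congr 1
  ext v
  unfold phiBeta
  ring

lemma bb_ibp_fst {s t : ℝ} (hs : 0 < s) (ht : 0 < t) (h h' : ℝ × ℝ → ℝ)
    (hc : Continuous h) (hc' : Continuous h')
    (hd : ∀ u v, HasDerivAt (fun u => h (u, v)) (h' (u, v)) u) :
    ∫ a, (a.1 * (1 - a.1) * h' a + (s - (s + t) * a.1) * h a) ∂(bb s t) = 0 := by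
  have := isProbabilityMeasureBeta hs ht
  have hi := bb_integrable hs ht
    (fun a => a.1 * (1 - a.1) * h' a + (s - (s + t) * a.1) * h a) (by fun_prop)
  unfold bb at hi ⊢
  rw [integral_prod_symm _ hi]
  rw [← integral_zero ℝ ℝ (μ := betaMeasure s t)]
  congr 1
  ext v
  exact beta_ibp hs ht (fun u => h (u, v)) (fun u => h' (u, v)) (by fun_prop) (fun u => hd u v)

lemma bb_ibp_snd {s t : ℝ} (hs : 0 < s) (ht : 0 < t) (h h' : ℝ × ℝ → ℝ)
    (hc : Continuous h) (hc' : Continuous h')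
    (hd : ∀ u v, HasDerivAt (fun v => h (u, v)) (h' (u, v)) v) :
    ∫ a, (a.2 * (1 - a.2) * h' a + (s - (s + t) * a.2) * h a) ∂(bb s t) = 0 := by
  have := isProbabilityMeasureBeta hs ht
  have hi := bb_integrable hs ht
    (fun a => a.2 * (1 - a.2) * h' a + (s - (s + t) * a.2) * h a) (by fun_prop)
  unfold bb at hi ⊢
  rw [integral_prod _ hi]
  rw [← integral_zero ℝ ℝ (μ := betaMeasure s t)]
  congr 1
  ext u
  exact beta_ibp hs ht (fun v => h (u, v)) (fun v => h' (u, v)) (by fun_prop) (fun v => hd u v)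

open MvPolynomial in
/-- The lowering operator on polynomials. -/
noncomputable def kPoly (s t : ℝ) (p : MvPolynomial (Fin 2) ℝ) : MvPolynomial (Fin 2) ℝ :=
  X 0 * pderiv 0 (pderiv 0 p) + C (s + t) * pderiv 0 p
    + X 1 * pderiv 1 (pderiv 1 p) + C (s + t) * pderiv 1 p

lemma ev2_kPoly (s t : ℝ) (p : MvPolynomial (Fin 2) ℝ) (x y : ℝ) :
    ev2 (kPoly s t p) x y = x * ev2 (MvPolynomial.pderiv 0 (MvPolynomial.pderiv 0 p)) x y
      + (s + t) * ev2 (MvPolynomial.pderiv 0 p) x y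
      + y * ev2 (MvPolynomial.pderiv 1 (MvPolynomial.pderiv 1 p)) x y
      + (s + t) * ev2 (MvPolynomial.pderiv 1 p) x y := by
  simp [ev2, kPoly]

lemma ev2_d0 (p : MvPolynomial (Fin 2) ℝ) (x y : ℝ) :
    HasDerivAt (fun x => ev2 p x y) (ev2 (MvPolynomial.pderiv 0 p) x y) x := by
  simpa using ev2_hasDerivAt p (fun x => x) (fun _ => y) 1 0 x (hasDerivAt_id x)
    (hasDerivAt_const x y)

lemma ev2_d1 (p : MvPolynomial (Fin 2) ℝ) (x y : ℝ) :
    HasDerivAt (fun y => ev2 p x y) (ev2 (MvPolynomial.pderiv 1 p) x y) y := by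
  simpa using ev2_hasDerivAt p (fun _ => x) (fun y => y) 0 1 y (hasDerivAt_const y x)
    (hasDerivAt_id y)

lemma contKminus_of (s t : ℝ) (f f1 f11 f2 f22 : ℝ → ℝ → ℝ)
    (h1 : ∀ x y, HasDerivAt (fun x => f x y) (f1 x y) x)
    (h11 : ∀ x y, HasDerivAt (fun x => f1 x y) (f11 x y) x)
    (h2 : ∀ x y, HasDerivAt (fun y => f x y) (f2 x y) y)
    (h22 : ∀ x y, HasDerivAt (fun y => f2 x y) (f22 x y) y) (x y : ℝ) :
    contKminus s t f x y
      = x * f11 x y + (s + t) * f1 x y + y * f22 x y + (s + t) * f2 x y := by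
  unfold contKminus
  have e1 : ∀ x, deriv (fun x => f x y) x = f1 x y := fun x => (h1 x y).deriv
  have e2 : ∀ y, deriv (fun y => f x y) y = f2 x y := fun y => (h2 x y).deriv
  simp only [e1, e2, (h11 x y).deriv, (h22 x y).deriv]

lemma kminus_ev2 (s t : ℝ) (p : MvPolynomial (Fin 2) ℝ) :
    contKminus s t (ev2 p) = ev2 (kPoly s t p) := by
  funext x y
  rw [ev2_kPoly]
  exact contKminus_of s t _ _ _ _ _ (ev2_d0 p) (ev2_d0 _) (ev2_d1 p) (ev2_d1 _) x y

lemma pderiv_swap (p : MvPolynomial (Fin 2) ℝ) :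
    MvPolynomial.pderiv 0 (MvPolynomial.pderiv 1 p)
      = MvPolynomial.pderiv 1 (MvPolynomial.pderiv 0 p) := by
  induction p using MvPolynomial.induction_on with
  | C c => simp
  | add p q hp hq => simp [hp, hq]
  | mul_X p i hp =>
    fin_cases i <;> simp [MvPolynomial.pderiv_mul, MvPolynomial.pderiv_X, hp] <;> ring

open MvPolynomial in
lemma main_ev2 (s t : ℝ) (hs : 0 < s) (ht : 0 < t) (p : MvPolynomial (Fin 2) ℝ) (x y : ℝ) :
    contGen s t (contKminus s t (ev2 p)) x y = contKminus s t (contGen s t (ev2 p)) x y := by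
  have hgen : contGen s t (ev2 p) = fun x y =>
      ∫ a, ev2 p (x * (1 - a.1) + y * a.2) (y * (1 - a.2) + x * a.1) ∂(bb s t) - ev2 p x y := by
    funext x y
    exact contGen_eq hs ht p x y
  -- chain rule facts
  have cx : ∀ (q : MvPolynomial (Fin 2) ℝ) (x y : ℝ) (a : ℝ × ℝ),
      HasDerivAt (fun x => ev2 q (x * (1 - a.1) + y * a.2) (y * (1 - a.2) + x * a.1))
        ((1 - a.1) * ev2 (pderiv 0 q) (x * (1 - a.1) + y * a.2) (y * (1 - a.2) + x * a.1)
          + a.1 * ev2 (pderiv 1 q) (x * (1 - a.1) + y * a.2) (y * (1 - a.2) + x * a.1)) x := by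
    intro q x y a
    refine ev2_hasDerivAt q _ _ _ _ x ?_ ?_
    · simpa using ((hasDerivAt_id x).mul_const (1 - a.1)).add_const (y * a.2)
    · simpa using ((hasDerivAt_id x).mul_const a.1).const_add (y * (1 - a.2))
  have cy : ∀ (q : MvPolynomial (Fin 2) ℝ) (x y : ℝ) (a : ℝ × ℝ),
      HasDerivAt (fun y => ev2 q (x * (1 - a.1) + y * a.2) (y * (1 - a.2) + x * a.1))
        (a.2 * ev2 (pderiv 0 q) (x * (1 - a.1) + y * a.2) (y * (1 - a.2) + x * a.1)
          + (1 - a.2) * ev2 (pderiv 1 q) (x * (1 - a.1) + y * a.2) (y * (1 - a.2) + x * a.1)) y := by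
    intro q x y a
    refine ev2_hasDerivAt q _ _ _ _ y ?_ ?_
    · simpa using ((hasDerivAt_id y).mul_const a.2).const_add (x * (1 - a.1))
    · simpa using ((hasDerivAt_id y).mul_const (1 - a.2)).add_const (x * a.1)
  have K := contKminus_of s t _ _ _ _ _
    (fun x y => (bb_deriv hs ht _ _ (fun x => by fun_prop) (by fun_prop)
      (fun x a => cx p x y a) x).sub (ev2_d0 p x y))
    (fun x y => (bb_deriv hs ht _ _ (fun x => by fun_prop) (by fun_prop)
      (fun x a => ((cx (pderiv 0 p) x y a).const_mul (1 - a.1)).add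
        ((cx (pderiv 1 p) x y a).const_mul a.1)) x).sub (ev2_d0 _ x y))
    (fun x y => (bb_deriv hs ht _ _ (fun x => by fun_prop) (by fun_prop)
      (fun y a => cy p x y a) y).sub (ev2_d1 p x y))
    (fun x y => (bb_deriv hs ht _ _ (fun x => by fun_prop) (by fun_prop)
      (fun y a => ((cy (pderiv 0 p) x y a).const_mul a.2).add
        ((cy (pderiv 1 p) x y a).const_mul (1 - a.2))) y).sub (ev2_d1 _ x y)) x y
  rw [hgen, kminus_ev2, contGen_eq hs ht]
  refine Eq.trans ?_ K.symm
  rw [ev2_kPoly]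
  simp only [pderiv_swap]
  have I1 := bb_ibp_fst hs ht
    (fun a => ev2 (pderiv 0 p) (x * (1 - a.1) + y * a.2) (y * (1 - a.2) + x * a.1)
      - ev2 (pderiv 1 p) (x * (1 - a.1) + y * a.2) (y * (1 - a.2) + x * a.1))
    (fun a => -x * (ev2 (pderiv 0 (pderiv 0 p)) (x * (1 - a.1) + y * a.2) (y * (1 - a.2) + x * a.1)
      - 2 * ev2 (pderiv 1 (pderiv 0 p)) (x * (1 - a.1) + y * a.2) (y * (1 - a.2) + x * a.1)
      + ev2 (pderiv 1 (pderiv 1 p)) (x * (1 - a.1) + y * a.2) (y * (1 - a.2) + x * a.1)))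
    (by fun_prop) (by fun_prop) (by
      intro u v
      have dX : HasDerivAt (fun u : ℝ => x * (1 - u) + y * v) (-x) u := by
        simpa using (((hasDerivAt_id u).const_sub 1).const_mul x).add_const (y * v)
      have dY : HasDerivAt (fun u : ℝ => y * (1 - v) + x * u) x u := by
        simpa using ((hasDerivAt_id u).const_mul x).const_add (y * (1 - v))
      refine ((ev2_hasDerivAt (pderiv 0 p) _ _ _ _ u dX dY).sub
        (ev2_hasDerivAt (pderiv 1 p) _ _ _ _ u dX dY)).congr_deriv ?_
      rw [pderiv_swap]
      ring)
  have I2 := bb_ibp_snd hs ht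
    (fun a => ev2 (pderiv 0 p) (x * (1 - a.1) + y * a.2) (y * (1 - a.2) + x * a.1)
      - ev2 (pderiv 1 p) (x * (1 - a.1) + y * a.2) (y * (1 - a.2) + x * a.1))
    (fun a => y * (ev2 (pderiv 0 (pderiv 0 p)) (x * (1 - a.1) + y * a.2) (y * (1 - a.2) + x * a.1)
      - 2 * ev2 (pderiv 1 (pderiv 0 p)) (x * (1 - a.1) + y * a.2) (y * (1 - a.2) + x * a.1)
      + ev2 (pderiv 1 (pderiv 1 p)) (x * (1 - a.1) + y * a.2) (y * (1 - a.2) + x * a.1)))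
    (by fun_prop) (by fun_prop) (by
      intro u v
      have dX : HasDerivAt (fun v : ℝ => x * (1 - u) + y * v) y v := by
        simpa using ((hasDerivAt_id v).const_mul y).const_add (x * (1 - u))
      have dY : HasDerivAt (fun v : ℝ => y * (1 - v) + x * u) (-y) v := by
        simpa using (((hasDerivAt_id v).const_sub 1).const_mul y).add_const (x * u)
      refine ((ev2_hasDerivAt (pderiv 0 p) _ _ _ _ v dX dY).sub
        (ev2_hasDerivAt (pderiv 1 p) _ _ _ _ v dX dY)).congr_deriv ?_
      rw [pderiv_swap]
      ring)
  have comb : ∀ (k1 k2 k3 k4 : ℝ) (A B C D E F G : ℝ × ℝ → ℝ), Continuous A → Continuous B → Continuous C →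
      Continuous D → Continuous E → Continuous F → Continuous G →
      (∀ a, G a = x * A a + (s + t) * B a + y * C a + (s + t) * D a - E a + F a) →
      ∫ a, E a ∂(bb s t) = 0 → ∫ a, F a ∂(bb s t) = 0 →
      ∫ a, G a ∂(bb s t) - (x * k1 + (s + t) * k2 + y * k3 + (s + t) * k4)
        = x * (∫ a, A a ∂(bb s t) - k1) + (s + t) * (∫ a, B a ∂(bb s t) - k2)
        + y * (∫ a, C a ∂(bb s t) - k3) + (s + t) * (∫ a, D a ∂(bb s t) - k4) := by
    intro k1 k2 k3 k4 A B C D E F G hA hB hC hD hE hF hG h hE0 hF0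
    have J := fun (g : ℝ × ℝ → ℝ) (hg : Continuous g) => bb_integrable hs ht g hg
    simp only [h]
    rw [integral_add (J _ (by fun_prop)) (J _ hF), integral_sub (J _ (by fun_prop)) (J _ hE),
      integral_add (J _ (by fun_prop)) (J _ (by fun_prop)),
      integral_add (J _ (by fun_prop)) (J _ (by fun_prop)),
      integral_add (J _ (by fun_prop)) (J _ (by fun_prop)), hE0, hF0]
    simp only [integral_const_mul]
    ring
  refine comb _ _ _ _ _ _ _ _ _ _ _ ?_ ?_ ?_ ?_ ?_ ?_ ?_ ?_ I1 I2
  all_goals first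
    | fun_prop
    | skip
  intro a
  rw [ev2_kPoly]
  ring

/-- For every polynomial function f, the generator of the continuous
generalized Immediate Exchange Model commutes with the SU(1,1) lowering operator:
`L_{s,t}((𝒦⁻₁+𝒦⁻₂)f)(x,y) = (𝒦⁻₁+𝒦⁻₂)(L_{s,t} f)(x,y)` for all x,y ≥ 0. -/
theorem continuous_generator_commutes_with_lowering
    (s t : ℝ) (hs : 0 < s) (ht : 0 < t) (f : ℝ → ℝ → ℝ)
    (hf : ∃ p : MvPolynomial (Fin 2) ℝ, ∀ x y : ℝ, f x y = MvPolynomial.eval ![x, y] p)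
    (x y : ℝ) (hx : 0 ≤ x) (hy : 0 ≤ y) :
    contGen s t (contKminus s t f) x y = contKminus s t (contGen s t f) x y := by

  obtain ⟨p, hp⟩ := hf
  have hfe : f = ev2 p := by
    funext a b
    exact hp a b
  rw [hfe]
  exact main_ev2 s t hs ht p x y
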